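/- There exists a constant 𝓡 > 2 such that for every R ≥ 𝓡 the following holds: there exist a frequency triple (ω, m, Ĵ), with ω ∈ ℝ and m, Ĵ ∈ ℤ, and bounded sets Ω', Ω with the closure of Ω' contained in Ω and Ω ⊂ [2,R]×[0,π), such that the potential V^ring_{(ω,m,Ĵ)} is negative at every point of Ω', vanishes at every point of ∂Ω', and is positive at every point of Ω ∖ closure(Ω'). -/

import Mathlib

noncomputable section
open Real Set Filter MeasureTheory

/-- The boost parameter `β = β_R`, defined by `cosh²β = 2R²/(4 + R²)`, `β ≥ 0`. -/
def βRing (R : ℝ) : ℝ := Real.arsinh (Real.sqrt ((R ^ 2 - 4) / (4 + R ^ 2)))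

/-- The limiting boost parameter `β₀`, with `cosh β₀ = √2`. -/
def β₀ : ℝ := Real.arsinh 1

/-- `f₁(r,θ)`. -/
def f₁ (R r θ : ℝ) : ℝ :=
  (r - 2) * (R + r * Real.cos θ) ^ 2 /
    (R * r ^ 3 * (2 * Real.cos θ + R) * Real.sin θ ^ 2)

/-- `f₂(r,θ)`. -/
def f₂ (R r θ : ℝ) : ℝ :=
  4 * (R - r) * (R + r * Real.cos θ) ^ 2 *
      (R * Real.sinh (2 * βRing R) ^ 2
        + 8 * Real.cosh (βRing R) ^ 4 * Real.sinh (βRing R) ^ 2) /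
    (4 * r * R * (r + R) * (R - 2 * Real.cosh (βRing R) ^ 2) *
      (r - 2 * Real.cosh (βRing R) ^ 2) *
      (R + 2 * Real.cosh (βRing R) ^ 2 * Real.cos θ))
  - (r - 2) * (R + 2 * Real.cosh (βRing R) ^ 2 * Real.cos θ) /
      (R * (r - 2 * Real.cosh (βRing R) ^ 2))

/-- `f₃(r,θ)`. -/
def f₃ (R r θ : ℝ) : ℝ :=
  (4 * Real.sinh (βRing R) * Real.cosh (βRing R) * (R + r * Real.cos θ) ^ 2 /
      (r * R * (R + r) * (2 * Real.cosh (βRing R) ^ 2 * Real.cos θ + R))) *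
    Real.sqrt ((R + 2 * Real.cosh (βRing R) ^ 2) / (R - 2 * Real.cosh (βRing R) ^ 2))

/-- `f₄(r,θ)`. -/
def f₄ (R r θ : ℝ) : ℝ :=
  (r - 2 * Real.cosh (βRing R) ^ 2) * (R + r * Real.cos θ) ^ 2 /
    (r * R * (R ^ 2 - r ^ 2) * (2 * Real.cosh (βRing R) ^ 2 * Real.cos θ + R))

/-- The black ring potential `V^ring_{(ω,m,Jh)} = f₁m² + f₂ω² + f₃ωJh + f₄Jh²`. -/
def Vring (R ω m Jh r θ : ℝ) : ℝ :=
  f₁ R r θ * m ^ 2 + f₂ R r θ * ω ^ 2 + f₃ R r θ * (ω * Jh) + f₄ R r θ * Jh ^ 2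

/-- The boosted black string potential (with `r₀ = 2` and boost `β₀`):
`V̂^{β₀}_{(ω,m,J)}(r,θ)`. -/
def VhatB0 (ω m J r θ : ℝ) : ℝ :=
  ((1 - 2 / r) / (r ^ 2 * Real.sin θ ^ 2)) * m ^ 2
    - (2 / r) * (ω * Real.sinh β₀ + J * Real.cosh β₀) ^ 2 + J ^ 2 - ω ^ 2

open Topology

/-- The ring potential at frequencies `(ω, m, R J)`, written in terms of `ε = 1 / R` so that it
extends continuously to `ε = 0`. Here `p = ((ε, J), (r, θ))`. -/
def rescaledRing (ω m : ℝ) (p : (ℝ × ℝ) × (ℝ × ℝ)) : ℝ :=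
  let ε := p.1.1
  let J := p.1.2
  let r := p.2.1
  let c := Real.cos p.2.2
  let s := Real.sin p.2.2
  let C := 2 / (1 + 4 * ε ^ 2)
  let S := (1 - 4 * ε ^ 2) / (1 + 4 * ε ^ 2)
  (r - 2) * (1 + ε * r * c) ^ 2 / (r ^ 3 * (1 + 2 * ε * c) * s ^ 2) * m ^ 2
    + (4 * (1 - ε * r) * (1 + ε * r * c) ^ 2 * (4 * S * C + 8 * C ^ 2 * S * ε) /
        (4 * r * (1 + ε * r) * (1 - 2 * C * ε) * (r - 2 * C) * (1 + 2 * C * ε * c))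
      - (r - 2) * (1 + 2 * C * ε * c) / (r - 2 * C)) * ω ^ 2
    + 4 * √S * √C * (1 + ε * r * c) ^ 2 / (r * (1 + ε * r) * (1 + 2 * C * ε * c)) *
        √((1 + 2 * C * ε) / (1 - 2 * C * ε)) * (ω * J)
    + (r - 2 * C) * (1 + ε * r * c) ^ 2 / (r * (1 - ε ^ 2 * r ^ 2) * (1 + 2 * C * ε * c)) * J ^ 2

lemma sinh_βRing (R : ℝ) : Real.sinh (βRing R) = √((R ^ 2 - 4) / (4 + R ^ 2)) :=
  Real.sinh_arsinh _

lemma sinh_sq_βRing {R : ℝ} (hR : 2 ≤ R) :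
    Real.sinh (βRing R) ^ 2 = (R ^ 2 - 4) / (4 + R ^ 2) := by
  rw [sinh_βRing, Real.sq_sqrt]
  exact div_nonneg (by nlinarith) (by positivity)

lemma cosh_sq_βRing {R : ℝ} (hR : 2 ≤ R) :
    Real.cosh (βRing R) ^ 2 = 2 * R ^ 2 / (4 + R ^ 2) := by
  rw [Real.cosh_sq, sinh_sq_βRing hR]
  field_simp
  ring

lemma boost_bounds (ε : ℝ) :
    0 < 2 / (1 + 4 * ε ^ 2) ∧ 2 / (1 + 4 * ε ^ 2) ≤ 2 :=
  ⟨by positivity, div_le_self (by norm_num) (by nlinarith [sq_nonneg ε])⟩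

/-- The denominators in the rescaled potential do not vanish. -/
lemma rescaledRing_denominators {ε r c C : ℝ} (hε : 0 ≤ ε) (hε' : ε ≤ 1 / 4000) (hr : 5 ≤ r)
    (hr' : r ≤ 1000) (hc : -1 ≤ c) (hC : 0 < C) (hC' : C ≤ 2) :
    0 < 1 + 2 * ε * c ∧ 0 < 1 + ε * r ∧ 0 < 1 - ε * r ∧ 0 < 1 - 2 * C * ε ∧ 0 < r - 2 * C ∧
      0 < 1 + 2 * C * ε * c := by
  have hεr : ε * r ≤ 1 / 4000 * 1000 := by gcongr
  have hεr0 : 0 ≤ ε * r := by positivity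
  have hCε : C * ε ≤ 2 * (1 / 4000) := by gcongr
  have hCε0 : 0 ≤ C * ε := by positivity
  refine ⟨?_, ?_, ?_, ?_, ?_, ?_⟩ <;> nlinarith

lemma Vring_eq_rescaledRing {R ω m Jh r θ : ℝ} (hR : 4000 ≤ R) (hr : 5 ≤ r) (hr' : r ≤ 1000)
    (hθ : 0 < Real.sin θ) :
    Vring R ω m Jh r θ = rescaledRing ω m ((1 / R, Jh / R), (r, θ)) := by
  have hR0 : 0 < R := by linarith
  have hR2 : 2 ≤ R := by linarith
  have hε' : 1 / R ≤ 1 / 4000 := one_div_le_one_div_of_le (by norm_num) hR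
  have hC : Real.cosh (βRing R) ^ 2 = 2 / (1 + 4 * (1 / R) ^ 2) := by
    rw [cosh_sq_βRing hR2]; field_simp; ring
  have hS : Real.sinh (βRing R) ^ 2 = (1 - 4 * (1 / R) ^ 2) / (1 + 4 * (1 / R) ^ 2) := by
    rw [sinh_sq_βRing hR2]; field_simp; ring
  have hC1 : Real.cosh (βRing R) = √(2 / (1 + 4 * (1 / R) ^ 2)) := by
    rw [← hC, Real.sqrt_sq (Real.cosh_pos _).le]
  have hS1 : Real.sinh (βRing R) = √((1 - 4 * (1 / R) ^ 2) / (1 + 4 * (1 / R) ^ 2)) := by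
    rw [← hS, Real.sqrt_sq]
    rw [sinh_βRing]; positivity
  obtain ⟨d1, d2, d3, d4, d5, d6⟩ := rescaledRing_denominators (ε := 1 / R) (by positivity) hε'
    hr hr' (Real.neg_one_le_cos θ) (boost_bounds (1 / R)).1 (boost_bounds (1 / R)).2
  simp only [Vring, f₁, f₂, f₃, f₄, rescaledRing, Real.sinh_two_mul]
  rw [← hC] at d4 d5 d6
  rw [← hC1, ← hS1, ← hC, ← hS]
  clear hC hS hC1 hS1
  generalize Real.cosh (βRing R) = x at *
  generalize Real.sinh (βRing R) = y at *
  generalize Real.cos θ = c at *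
  generalize Real.sin θ = s at *
  have e1 : 2 * c + R = R * (1 + 2 * (1 / R) * c) := by field_simp; ring
  have e2 : r + R = R * (1 + 1 / R * r) := by field_simp; ring
  have e2' : R + r = R * (1 + 1 / R * r) := by field_simp
  have e3 : R - r = R * (1 - 1 / R * r) := by field_simp
  have e4 : R - 2 * x ^ 2 = R * (1 - 2 * x ^ 2 * (1 / R)) := by field_simp
  have e4' : R + 2 * x ^ 2 = R * (1 + 2 * x ^ 2 * (1 / R)) := by field_simp
  have e6 : R + 2 * x ^ 2 * c = R * (1 + 2 * x ^ 2 * (1 / R) * c) := by field_simp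
  have e6' : 2 * x ^ 2 * c + R = R * (1 + 2 * x ^ 2 * (1 / R) * c) := by field_simp; ring
  have e7 : R + r * c = R * (1 + 1 / R * r * c) := by field_simp
  have e8 : R ^ 2 - r ^ 2 = R ^ 2 * ((1 - 1 / R * r) * (1 + 1 / R * r)) := by field_simp; ring
  have e9 : 1 - (1 / R) ^ 2 * r ^ 2 = (1 - 1 / R * r) * (1 + 1 / R * r) := by ring
  rw [e1, e2, e2', e3, e4, e4', e6, e6', e7, e8, e9, mul_div_mul_left _ _ hR0.ne']
  generalize √((1 + 2 * x ^ 2 * (1 / R)) / (1 - 2 * x ^ 2 * (1 / R))) = q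
  clear e1 e2 e2' e3 e4 e4' e6 e6' e7 e8 e9
  have e10 : R * (2 * y * x) ^ 2 + 8 * x ^ 4 * y ^ 2
      = R * (4 * y ^ 2 * x ^ 2 + 8 * (x ^ 2) ^ 2 * y ^ 2 * (1 / R)) := by field_simp; ring
  rw [e10]
  generalize 4 * y ^ 2 * x ^ 2 + 8 * (x ^ 2) ^ 2 * y ^ 2 * (1 / R) = z
  generalize 1 + 2 * (1 / R) * c = a1 at *
  generalize 1 + 1 / R * r * c = a7 at *
  generalize 1 + 1 / R * r = a2 at *
  generalize 1 - 1 / R * r = a3 at *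
  generalize 1 - 2 * x ^ 2 * (1 / R) = a4 at *
  generalize r - 2 * x ^ 2 = a5 at *
  generalize 1 + 2 * x ^ 2 * (1 / R) * c = a6 at *
  have hr0 : 0 < r := by linarith
  congr 1
  · congr 1
    · congr 1
      · field_simp
      · congr 1
        field_simp
    · field_simp
  · field_simp

lemma continuousAt_rescaledRing (ω m J : ℝ) {ε r θ : ℝ} (hε : 0 ≤ ε) (hε' : ε ≤ 1 / 4000)
    (hr : 5 ≤ r) (hr' : r ≤ 1000) (hθ : 0 < Real.sin θ) :
    ContinuousAt (rescaledRing ω m) ((ε, J), (r, θ)) := by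
  obtain ⟨d1, d2, d3, d4, d5, d6⟩ := rescaledRing_denominators hε hε'
    hr hr' (Real.neg_one_le_cos θ) (boost_bounds ε).1 (boost_bounds ε).2
  have d7 : 1 - ε ^ 2 * r ^ 2 ≠ 0 := by
    rw [show 1 - ε ^ 2 * r ^ 2 = (1 - ε * r) * (1 + ε * r) by ring]
    positivity
  have d8 : 1 + 4 * ε ^ 2 ≠ 0 := by positivity
  have hr0 : r ≠ 0 := by linarith
  unfold rescaledRing
  fun_prop (disch := simp only [ne_eq, mul_eq_zero, pow_eq_zero_iff, OfNat.ofNat_ne_zero,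
    not_false_eq_true, not_or]; try simp only [d7, hr0, d1.ne', d2.ne', d4.ne', d5.ne', d6.ne',
    hθ.ne', not_false_eq_true, and_self])

lemma sinh_β₀ : Real.sinh β₀ = 1 := Real.sinh_arsinh 1

lemma cosh_β₀ : Real.cosh β₀ = √2 := by
  rw [β₀, Real.cosh_arsinh]
  norm_num

/-- As `R → ∞` the rescaled ring potential becomes the boosted black string potential with
`ω` reflected. -/
lemma rescaledRing_zero (ω m J : ℝ) {r θ : ℝ} (hr : 4 < r) (hθ : 0 < Real.sin θ) :
    rescaledRing ω m ((0, J), (r, θ)) = VhatB0 (-ω) m J r θ := by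
  have h4 : r - 4 ≠ 0 := by linarith
  have hr0 : r ≠ 0 := by linarith
  have hsq : √2 ^ 2 = (2 : ℝ) := Real.sq_sqrt (by norm_num)
  have h22 : r - 2 * 2 ≠ 0 := by norm_num; exact h4
  simp only [rescaledRing, VhatB0, sinh_β₀, cosh_β₀]
  norm_num
  field_simp
  ring_nf
  simp only [hsq]
  ring

/-- A continuous function on a closed set, positive on its frontier and negative somewhere,
has a trapped negative region. -/
lemma exists_trapped_region {X : Type*} [TopologicalSpace X] {K : Set X} {f : X → ℝ}
    (hK : IsClosed K) (hf : ContinuousOn f K) (hpos : ∀ x ∈ frontier K, 0 < f x) {x₀ : X}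
    (hx₀ : x₀ ∈ K) (hneg : f x₀ < 0) :
    ∃ Ω' Ω : Set X, Ω'.Nonempty ∧ frontier K ⊆ Ω \ closure Ω' ∧ closure Ω' ⊆ Ω ∧ Ω ⊆ K ∧
      (∀ x ∈ Ω', f x < 0) ∧ (∀ x ∈ frontier Ω', f x = 0) ∧
      ∀ x ∈ Ω \ closure Ω', 0 < f x := by
  have hΩK : closure {x ∈ K | f x < 0} ⊆ K := closure_minimal (fun x hx => hx.1) hK
  have hle : ∀ x ∈ closure {x ∈ K | f x < 0}, f x ≤ 0 := fun x hx =>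
    ((hf.preimage_isClosed_of_isClosed hK isClosed_Iic).closure_subset_iff.2
      (fun y hy => ⟨hy.1, hy.2.le⟩ : {x ∈ K | f x < 0} ⊆ K ∩ f ⁻¹' Iic 0) hx).2
  have hopen : IsOpen {x ∈ K | f x < 0} := by
    have h := (hf.mono interior_subset).isOpen_inter_preimage isOpen_interior
      (isOpen_Iio (a := (0 : ℝ)))
    convert h using 1
    ext x
    refine ⟨fun hx => ⟨?_, hx.2⟩, fun hx => ⟨interior_subset hx.1, hx.2⟩⟩
    by_contra hi
    exact (hpos x ⟨subset_closure hx.1, hi⟩).not_gt hx.2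
  refine ⟨{x ∈ K | f x < 0}, closure {x ∈ K | f x < 0} ∪ {x ∈ K | 0 < f x}, ⟨x₀, hx₀, hneg⟩,
    fun x hx => ⟨.inr ⟨hK.frontier_subset hx, hpos x hx⟩, fun h => (hle x h).not_gt (hpos x hx)⟩,
    subset_union_left, union_subset hΩK fun x hx => hx.1, fun x hx => hx.2, fun x hx => ?_,
    fun x hx => (hx.1.resolve_left hx.2).2⟩
  rw [hopen.frontier_eq] at hx
  exact le_antisymm (hle x hx.1) (not_lt.1 fun h => hx.2 ⟨hΩK hx.1, h⟩)

/-- The rectangle in the `(r, θ)` plane in which the trapping region is found. -/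
def trappingBox : Set (ℝ × ℝ) := Set.Icc 5 1000 ×ˢ Set.Icc (1 / 4) (π - 1 / 4)

lemma isCompact_trappingBox : IsCompact trappingBox := isCompact_Icc.prod isCompact_Icc

lemma sin_pos_of_mem_trappingBox {x : ℝ × ℝ} (hx : x ∈ trappingBox) : 0 < Real.sin x.2 :=
  Real.sin_pos_of_pos_of_lt_pi (by linarith [hx.2.1]) (by linarith [hx.2.2])

lemma equator_mem_trappingBox : ((15 : ℝ), π / 2) ∈ trappingBox := by
  have := Real.pi_gt_three
  exact ⟨⟨by norm_num, by norm_num⟩, by dsimp only; linarith, by dsimp only; linarith⟩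

lemma sin_sq_quarter_le : Real.sin (1 / 4) ^ 2 ≤ 1 / 16 := by
  have h1 : Real.sin (1 / 4) ≤ 1 / 4 := Real.sin_le (by norm_num)
  have h0 : 0 ≤ Real.sin (1 / 4) :=
    Real.sin_nonneg_of_nonneg_of_le_pi (by norm_num) (by linarith [Real.pi_gt_three])
  nlinarith

lemma VhatB0_trapping (r θ : ℝ) :
    VhatB0 (-(999 / 1000)) 2 1 r θ = 4 * (1 - 2 / r) / (r ^ 2 * Real.sin θ ^ 2)
      - 2 / r * (√2 - 999 / 1000) ^ 2 + 1999 / 1000000 := by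
  rw [VhatB0, sinh_β₀, cosh_β₀]
  ring

lemma trapping_coefficient_bounds :
    17 / 100 ≤ (√2 - 999 / 1000) ^ 2 ∧ (√2 - 999 / 1000) ^ 2 ≤ 1731 / 10000 := by
  have h1 : 1414 / 1000 ≤ √2 := Real.le_sqrt_of_sq_le (by norm_num)
  have h2 : √2 ≤ 1415 / 1000 := by rw [Real.sqrt_le_left (by norm_num)]; norm_num
  constructor <;> nlinarith

lemma VhatB0_equator_neg : VhatB0 (-(999 / 1000)) 2 1 15 (π / 2) < 0 := by
  rw [VhatB0_trapping, Real.sin_pi_div_two]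
  linarith [trapping_coefficient_bounds.1]

lemma VhatB0_pos_of_mem_frontier {x : ℝ × ℝ} (hx : x ∈ frontier trappingBox) :
    0 < VhatB0 (-(999 / 1000)) 2 1 x.1 x.2 := by
  have hmem : x ∈ trappingBox := isCompact_trappingBox.isClosed.frontier_subset hx
  have hs := sin_pos_of_mem_trappingBox hmem
  have hs1 : Real.sin x.2 ^ 2 ≤ 1 := Real.sin_sq_le_one _
  have hb := trapping_coefficient_bounds.2
  have hπ := Real.pi_gt_three
  rw [VhatB0_trapping]
  rw [trappingBox, frontier_prod_eq, frontier_Icc (by linarith), frontier_Icc (by norm_num),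
    closure_Icc, closure_Icc] at hx
  obtain ⟨r, θ⟩ := x
  dsimp only at hs hs1 ⊢
  have hr5 : 5 ≤ r := hmem.1.1
  have hr0 : 0 < r := by linarith
  have key : 2 / r * (√2 - 999 / 1000) ^ 2 ≤ 2 / r * (1731 / 10000) := by gcongr
  have h2r : 0 ≤ 1 - 2 / r - 3 / 5 := by
    rw [sub_sub, sub_nonneg, ← le_sub_iff_add_le, div_le_iff₀ hr0]; linarith
  have hlow : ∀ t : ℝ, Real.sin θ ^ 2 ≤ t →
      12 / 5 / (r ^ 2 * t) ≤ 4 * (1 - 2 / r) / (r ^ 2 * Real.sin θ ^ 2) := by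
    intro t ht
    have : 0 < r ^ 2 * Real.sin θ ^ 2 := by positivity
    gcongr
    · linarith
    · linarith
  rcases hx with ⟨-, hθ⟩ | ⟨hr, -⟩
  · have hsθ : Real.sin θ ^ 2 ≤ 1 / 16 := by
      rcases hθ with h | h
      · rw [show θ = 1 / 4 from h]; exact sin_sq_quarter_le
      · rw [show θ = π - 1 / 4 from h, Real.sin_pi_sub]; exact sin_sq_quarter_le
    have h1 := hlow _ hsθ
    have h2 : 12 / 5 / (r ^ 2 * (1 / 16)) = 192 / 5 * (1 / r) ^ 2 := by field_simp; norm_num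
    have h3 : 2 / r * (1731 / 10000) = 1731 / 5000 * (1 / r) := by field_simp; norm_num
    nlinarith [sq_nonneg (1 / r - 1 / 222)]
  · have h1 := hlow 1 hs1
    rcases hr with rfl | rfl <;> linarith

lemma eventually_trapping : ∀ᶠ q : ℝ × ℝ in 𝓝 (0, 1),
    rescaledRing (999 / 1000) 2 (q, (15, π / 2)) < 0 ∧
      ∀ x ∈ frontier trappingBox, 0 < rescaledRing (999 / 1000) 2 (q, x) := by
  have hcont : ∀ x ∈ trappingBox,
      ContinuousAt (rescaledRing (999 / 1000) 2) (((0 : ℝ), (1 : ℝ)), x) := fun x hx =>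
    continuousAt_rescaledRing _ _ _ le_rfl (by norm_num) hx.1.1 hx.1.2
      (sin_pos_of_mem_trappingBox hx)
  have hval : ∀ x ∈ trappingBox, rescaledRing (999 / 1000) 2 ((0, 1), x)
      = VhatB0 (-(999 / 1000)) 2 1 x.1 x.2 := fun x hx =>
    rescaledRing_zero _ _ _ (by linarith [hx.1.1]) (sin_pos_of_mem_trappingBox hx)
  have hF : frontier trappingBox ⊆ trappingBox := isCompact_trappingBox.isClosed.frontier_subset
  refine .and ?_ ?_
  · have hslice : ContinuousAt (fun q : ℝ × ℝ => rescaledRing (999 / 1000) 2 (q, (15, π / 2)))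
        (0, 1) :=
      ContinuousAt.comp (f := fun q : ℝ × ℝ => (q, ((15 : ℝ), π / 2)))
        (hcont _ equator_mem_trappingBox) (by fun_prop)
    refine hslice.eventually_lt_const ?_
    exact (hval _ equator_mem_trappingBox).trans_lt VhatB0_equator_neg
  · refine (isCompact_trappingBox.of_isClosed_subset isClosed_frontier
      hF).eventually_forall_of_forall_eventually fun x hx => ?_
    refine (hcont x (hF hx)).eventually_const_lt ?_
    rw [hval x (hF hx)]
    exact VhatB0_pos_of_mem_frontier hx

/-- For large `R` the ring potential with frequencies `(999/1000, 2, ⌊R⌋₊)` has a nonempty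
negative region enclosed, inside `trappingBox`, by a region where it is positive. -/
theorem eventually_exists_nonempty_trapped_region : ∀ᶠ R : ℝ in atTop,
    ∃ Ω' Ω : Set (ℝ × ℝ), Ω'.Nonempty ∧ frontier trappingBox ⊆ Ω \ closure Ω' ∧
      closure Ω' ⊆ Ω ∧ Ω ⊆ trappingBox ∧
      (∀ x ∈ Ω', Vring R (999 / 1000) 2 ⌊R⌋₊ x.1 x.2 < 0) ∧
      (∀ x ∈ frontier Ω', Vring R (999 / 1000) 2 ⌊R⌋₊ x.1 x.2 = 0) ∧
      (∀ x ∈ Ω \ closure Ω', 0 < Vring R (999 / 1000) 2 ⌊R⌋₊ x.1 x.2) := by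
  have hlim : Tendsto (fun R : ℝ => (1 / R, (⌊R⌋₊ : ℝ) / R)) atTop (𝓝 (0, 1)) :=
    (tendsto_const_nhds.div_atTop tendsto_id).prodMk_nhds tendsto_nat_floor_div_atTop
  filter_upwards [hlim.eventually eventually_trapping, eventually_ge_atTop 4000]
    with R ⟨hneg, hpos⟩ hR
  have heq : ∀ x ∈ trappingBox, Vring R (999 / 1000) 2 ⌊R⌋₊ x.1 x.2
      = rescaledRing (999 / 1000) 2 ((1 / R, ⌊R⌋₊ / R), x) := fun x hx =>
    Vring_eq_rescaledRing hR hx.1.1 hx.1.2 (sin_pos_of_mem_trappingBox hx)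
  have hclosed := isCompact_trappingBox.isClosed
  refine exists_trapped_region hclosed ?_ (fun x hx => ?_) equator_mem_trappingBox ?_
  · refine ContinuousOn.congr (fun x hx => ContinuousAt.continuousWithinAt ?_) heq
    refine ContinuousAt.comp (f := fun x : ℝ × ℝ => ((1 / R, (⌊R⌋₊ : ℝ) / R), x))
      (continuousAt_rescaledRing _ _ _ (by positivity)
        (one_div_le_one_div_of_le (by norm_num) hR) hx.1.1 hx.1.2
        (sin_pos_of_mem_trappingBox hx)) (by fun_prop)
  · rw [heq x (hclosed.frontier_subset hx)]
    exact hpos x hx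
  · rw [heq _ equator_mem_trappingBox]
    exact hneg

/-- stable trapping for black rings. For `R` large there is a frequency
triple `(ω, m, Ĵ)` and bounded sets `Ω' ⋐ Ω ⊆ [2,R]×[0,π)` on which the ring potential is
negative, vanishes on `∂Ω'`, and is positive on `Ω ∖ clos(Ω')`. -/
theorem statement14 :
    ∃ 𝓡 : ℝ, 2 < 𝓡 ∧ ∀ R : ℝ, 𝓡 ≤ R →
      ∃ (ω : ℝ) (m Jh : ℤ) (Ω' Ω : Set (ℝ × ℝ)),
        Bornology.IsBounded Ω' ∧ Bornology.IsBounded Ω ∧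
        closure Ω' ⊆ Ω ∧ Ω ⊆ Set.Icc 2 R ×ˢ Set.Ico 0 Real.pi ∧
        (∀ x ∈ Ω', Vring R ω (m : ℝ) (Jh : ℝ) x.1 x.2 < 0) ∧
        (∀ x ∈ frontier Ω', Vring R ω (m : ℝ) (Jh : ℝ) x.1 x.2 = 0) ∧
        (∀ x ∈ Ω \ closure Ω', 0 < Vring R ω (m : ℝ) (Jh : ℝ) x.1 x.2) := by
  obtain ⟨A, hA⟩ := eventually_atTop.1 eventually_exists_nonempty_trapped_region
  refine ⟨max A 4000, by norm_num, fun R hR => ?_⟩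
  obtain ⟨Ω', Ω, -, -, hcl, hbox, hneg, hzero, hpos⟩ := hA R ((le_max_left _ _).trans hR)
  have hbdd : Bornology.IsBounded Ω := isCompact_trappingBox.isBounded.subset hbox
  refine ⟨999 / 1000, 2, ⌊R⌋₊, Ω', Ω, hbdd.subset (subset_closure.trans hcl), hbdd, hcl,
    hbox.trans (Set.prod_mono (Set.Icc_subset_Icc (by norm_num) ?_) fun θ hθ => ?_), ?_⟩
  · linarith [(le_max_right A 4000).trans hR]
  · exact ⟨by linarith [hθ.1], by linarith [hθ.2]⟩
  · push_cast
    exact ⟨hneg, hzero, hpos⟩
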